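/- arXiv:1512.08487 — 2 statements merged into one kernel-verified Lean document; each statement's English description precedes it below -/
import Mathlib

section
/- Let p > 1 and let W(u) = -(u+1)^2/2 + (1+u)^{p+1}/(p+1) + (p-1)/(2(p+1)). Under the change of variables u = e^t - 1, the function C(u) = d/du [ W(u)/W'(u)^2 ] satisfies, for all real t ≠ 0, C(e^t - 1) = - ((p-1)/(p+1)) · f_p(t) · e^{-(p+3)t/2}, where f_p(t) = (sinh(p t) - p sinh(t)) / (4 sinh^3((p-1)t/2)). -/
/-- The derivative of the shifted potential on `u > -1`. -/
lemma hasDerivAt_shifted_potential {p : ℝ} (hp : 1 < p) {u : ℝ} (hu : 0 < 1 + u) :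
    HasDerivAt (fun u : ℝ => -(u + 1) ^ 2 / 2 + (1 + u) ^ (p + 1) / (p + 1)
      + (p - 1) / (2 * (p + 1))) ((1 + u) ^ p - (1 + u)) u := by
  have hp1 : p + 1 ≠ 0 := by linarith
  have hsq := ((((hasDerivAt_id u).add_const 1).pow 2).neg).div_const 2
  have hpow := ((((hasDerivAt_id u).const_add 1).rpow_const (p := p + 1)
    (Or.inl hu.ne')).div_const (p + 1))
  refine ((hsq.add hpow).add_const ((p - 1) / (2 * (p + 1)))).congr_deriv ?_
  simp only [id, add_sub_cancel_right]
  field_simp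
  push_cast
  ring

/-- The derivative of `W / W'^2` at a point where `W'` does not vanish. -/
lemma hasDerivAt_div_deriv_sq {W W' : ℝ → ℝ} {u c : ℝ} (hW : HasDerivAt W (W' u) u)
    (hW' : HasDerivAt W' c u) (hne : W' u ≠ 0) :
    HasDerivAt (fun v => W v / W' v ^ 2) ((W' u ^ 2 - 2 * W u * c) / W' u ^ 3) u := by
  refine (hW.div (hW'.pow 2) (pow_ne_zero 2 hne)).congr_deriv ?_
  simp only [Pi.pow_apply]
  field_simp
  push_cast
  ring

/-- Under the change of variables `u = e^t - 1`, the function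
`C(u) = d/du [W(u)/W'(u)^2]` for the shifted potential
`W(u) = -(u+1)^2/2 + (1+u)^(p+1)/(p+1) + (p-1)/(2(p+1))` satisfies, for `t ≠ 0`,
`C(e^t - 1) = -((p-1)/(p+1)) · f_p(t) · e^{-(p+3)t/2}`, where
`f_p(t) = (sinh(pt) - p sinh t)/(4 sinh³((p-1)t/2))`. -/
theorem chicone_function_formula
    (p : ℝ) (hp : 1 < p)
    (W : ℝ → ℝ)
    (hW : ∀ u : ℝ, W u = -(u + 1) ^ 2 / 2 + (1 + u) ^ (p + 1) / (p + 1)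
      + (p - 1) / (2 * (p + 1)))
    (f : ℝ → ℝ)
    (hf : ∀ t : ℝ, f t = (Real.sinh (p * t) - p * Real.sinh t)
      / (4 * (Real.sinh ((p - 1) / 2 * t)) ^ 3))
    (t : ℝ) (ht : t ≠ 0) :
    deriv (fun v => W v / (deriv W v) ^ 2) (Real.exp t - 1)
      = -((p - 1) / (p + 1)) * f t * Real.exp (-(p + 3) * t / 2) := by
  have hx : 0 < Real.exp t := Real.exp_pos t
  have hderiv : ∀ v : ℝ, 0 < 1 + v → HasDerivAt W ((1 + v) ^ p - (1 + v)) v := fun v hv => by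
    rw [funext hW]
    exact hasDerivAt_shifted_potential hp hv
  have hpos : 0 < 1 + (Real.exp t - 1) := by linarith
  have hderiv₂ : HasDerivAt (fun v : ℝ => (1 + v) ^ p - (1 + v))
      (p * (1 + (Real.exp t - 1)) ^ (p - 1) - 1) (Real.exp t - 1) := by
    have hlin := (hasDerivAt_id (Real.exp t - 1)).const_add 1
    refine ((hlin.rpow_const (p := p) (Or.inl hpos.ne')).sub hlin).congr_deriv ?_
    simp
  have heq : (fun v => W v / (deriv W v) ^ 2) =ᶠ[nhds (Real.exp t - 1)]
      fun v => W v / ((1 + v) ^ p - (1 + v)) ^ 2 := by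
    have hnhds : ∀ᶠ v in nhds (Real.exp t - 1), 0 < 1 + v :=
      (continuous_const.add continuous_id).continuousAt.eventually (lt_mem_nhds hpos)
    filter_upwards [hnhds] with v hv
    rw [(hderiv v hv).deriv]
  obtain ⟨a, ha⟩ : ∃ a, a = Real.exp ((p - 1) / 2 * t) := ⟨_, rfl⟩
  have ha0 : 0 < a := ha ▸ Real.exp_pos _
  have ha1 : a ^ 2 - 1 ≠ 0 := by
    have hne : a ≠ 1 := by
      rw [ha, Ne, Real.exp_eq_one_iff]
      exact mul_ne_zero (by linarith) ht
    intro h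
    exact hne (by nlinarith)
  have hpow_sub : Real.exp t ^ (p - 1) = a ^ 2 := by
    rw [ha, ← Real.exp_mul, ← Real.exp_nat_mul]
    congr 1
    push_cast
    ring
  have hpow : Real.exp t ^ p = a ^ 2 * Real.exp t := by
    rw [← hpow_sub, ← Real.rpow_add_one hx.ne', sub_add_cancel]
  have hpow_add : Real.exp t ^ (p + 1) = a ^ 2 * Real.exp t ^ 2 := by
    rw [Real.rpow_add_one hx.ne', hpow]
    ring
  have hexp : Real.exp (p * t) = a ^ 2 * Real.exp t := by
    rw [← hpow, ← Real.exp_mul, mul_comm]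
  have hexp_neg : Real.exp (-(p + 3) * t / 2) = (a * Real.exp t ^ 2)⁻¹ := by
    rw [ha, ← Real.exp_nat_mul, ← Real.exp_add, ← Real.exp_neg]
    congr 1
    push_cast
    ring
  have hx1 : (1 : ℝ) + (Real.exp t - 1) = Real.exp t := by ring
  have hne : (1 + (Real.exp t - 1)) ^ p - (1 + (Real.exp t - 1)) ≠ 0 := by
    rw [hx1, hpow, ← sub_one_mul]
    exact mul_ne_zero ha1 hx.ne'
  rw [heq.deriv_eq, (hasDerivAt_div_deriv_sq (hderiv _ hpos) hderiv₂ hne).deriv, hf, hW,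
    Real.sinh_eq, Real.sinh_eq, Real.sinh_eq, Real.exp_neg, Real.exp_neg, Real.exp_neg,
    hexp, hexp_neg, ← ha, sub_add_cancel, hx1, hpow, hpow_sub, hpow_add]
  have hp1 : p + 1 ≠ 0 := by linarith
  generalize Real.exp t = x at hx
  have hW' : a ^ 2 * x - x = x * (a ^ 2 - 1) := by ring
  have hsinh : (a - a⁻¹) / 2 = (a ^ 2 - 1) / (2 * a) := by field_simp
  rw [hW', hsinh]
  field_simp
  ring
end

section
/- Let 1 < p < 3 and define J(t) = sinh⁴(((p-1)/2) t) · ( f_p'(t) - ((p+3)/2) f_p(t) ), where f_p(t) = (sinh(p t) - p sinh(t)) / (4 sinh^3((p-1)t/2)). Then J(t) < 0 and J is strictly decreasing for all t > 0. -/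
open Real in
/-- `exp (-p t) ≥ cosh t - p sinh t`, a consequence of Bernoulli's inequality. -/
lemma cosh_sub_mul_sinh_le_exp {p : ℝ} (hp : 1 < p) (t : ℝ) :
    cosh t - p * sinh t ≤ exp (-(p * t)) := by
  have hb : 1 + p * (exp (-t) - 1) ≤ (1 + (exp (-t) - 1)) ^ p :=
    one_add_mul_self_le_rpow_one_add (by linarith [exp_pos (-t)]) hp.le
  rw [add_sub_cancel, ← exp_mul, ← cosh_sub_sinh, show -t * p = -(p * t) by ring] at hb
  nlinarith [one_le_cosh t]

open Real in
lemma hasDerivAt_sinh_const_mul (c t : ℝ) :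
    HasDerivAt (fun t => sinh (c * t)) (c * cosh (c * t)) t := by
  simpa [mul_comm] using ((hasDerivAt_id t).const_mul c).sinh

open Real in
lemma hasDerivAt_cosh_const_mul (c t : ℝ) :
    HasDerivAt (fun t => cosh (c * t)) (c * sinh (c * t)) t := by
  simpa [mul_comm] using ((hasDerivAt_id t).const_mul c).cosh

open Real in
lemma hasDerivAt_sinh_mul_sub_mul_sinh (p t : ℝ) :
    HasDerivAt (fun t => sinh (p * t) - p * sinh t) (p * (cosh (p * t) - cosh t)) t :=
  ((hasDerivAt_sinh_const_mul p t).sub ((hasDerivAt_sinh t).const_mul p)).congr_deriv (by ring)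

open Real in
lemma mul_sinh_lt_sinh_mul {p t : ℝ} (hp : 1 < p) (ht : 0 < t) :
    p * sinh t < sinh (p * t) := by
  have hmono : StrictMonoOn (fun t => sinh (p * t) - p * sinh t) (Set.Ici 0) := by
    refine strictMonoOn_of_deriv_pos (convex_Ici 0)
      (fun x _ => (hasDerivAt_sinh_mul_sub_mul_sinh p x).continuousAt.continuousWithinAt) ?_
    intro x hx
    rw [interior_Ici, Set.mem_Ioi] at hx
    rw [(hasDerivAt_sinh_mul_sub_mul_sinh p x).deriv]
    have hlt : cosh x < cosh (p * x) := by
      rw [cosh_lt_cosh, abs_of_pos hx, abs_of_pos (by positivity)]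
      nlinarith
    exact mul_pos (by linarith) (by linarith)
  simpa using hmono Set.self_mem_Ici ht.le ht

open Real in
/-- The numerator `4 J`, cleared of denominators, is strictly decreasing. -/
lemma strictAntiOn_numerator {p : ℝ} (hp₁ : 1 < p) (hp₃ : p < 3) :
    StrictAntiOn (fun t => sinh ((p - 1) / 2 * t) * (p * (cosh (p * t) - cosh t))
      - 3 * ((p - 1) / 2) * cosh ((p - 1) / 2 * t) * (sinh (p * t) - p * sinh t)
      - (p + 3) / 2 * sinh ((p - 1) / 2 * t) * (sinh (p * t) - p * sinh t)) (Set.Ici 0) := by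
  obtain ⟨a, rfl⟩ : ∃ a, p = 1 + 2 * a := ⟨(p - 1) / 2, by ring⟩
  rw [show (1 + 2 * a - 1) / 2 = a by ring, show (1 + 2 * a + 3) / 2 = a + 2 by ring]
  have ha₀ : 0 < a := by linarith
  have ha₁ : a < 1 := by linarith
  have hder (t : ℝ) := by
    have hS := hasDerivAt_sinh_const_mul a t
    have hC := hasDerivAt_cosh_const_mul a t
    have hg := hasDerivAt_sinh_mul_sub_mul_sinh (1 + 2 * a) t
    have hg' := ((hasDerivAt_cosh_const_mul (1 + 2 * a) t).sub (hasDerivAt_cosh t)).const_mul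
      (1 + 2 * a)
    exact ((hS.mul hg').sub ((hC.const_mul (3 * a)).mul hg)).sub ((hS.const_mul (a + 2)).mul hg)
  refine strictAntiOn_of_deriv_neg (convex_Ici 0)
    (fun t _ => (hder t).continuousAt.continuousWithinAt) ?_
  intro t ht
  rw [interior_Ici, Set.mem_Ioi] at ht
  refine (hder t).deriv.trans_lt ?_
  have hS : 0 < sinh (a * t) := sinh_pos_iff.2 (by positivity)
  have hCS : sinh (a * t) < cosh (a * t) := sinh_lt_cosh _
  have hg := sub_pos.2 (mul_sinh_lt_sinh_mul hp₁ ht)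
  have hg' : (1 + 2 * a) * (sinh ((1 + 2 * a) * t) - (1 + 2 * a) * sinh t)
      ≤ (1 + 2 * a) * (cosh ((1 + 2 * a) * t) - cosh t) := by
    have hexp := cosh_sub_mul_sinh_le_exp hp₁ t
    rw [← cosh_sub_sinh] at hexp
    exact mul_le_mul_of_nonneg_left (by linarith) (by linarith)
  have hid : sinh (a * t) * (sinh ((1 + 2 * a) * t) + sinh t)
      = cosh (a * t) * (cosh ((1 + 2 * a) * t) - cosh t) := by
    rw [show (1 + 2 * a) * t = (t + a * t) + a * t by ring]
    have hsinh : sinh t = sinh ((t + a * t) - a * t) := by ring_nf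
    have hcosh : cosh t = cosh ((t + a * t) - a * t) := by ring_nf
    rw [hsinh, hcosh]
    generalize t + a * t = u
    rw [sinh_sub, cosh_sub, sinh_add, cosh_add]
    ring
  rw [Pi.sub_apply]
  generalize sinh (a * t) = S at *
  generalize cosh (a * t) = C at *
  generalize cosh ((1 + 2 * a) * t) - cosh t = d at *
  obtain ⟨g, hgdef⟩ : ∃ g, g = sinh ((1 + 2 * a) * t) - (1 + 2 * a) * sinh t := ⟨_, rfl⟩
  rw [← hgdef] at hg hg' ⊢
  have hSg : 0 < S * g := mul_pos hS hg
  have hCg : S * g < C * g := mul_lt_mul_of_pos_right hCS hg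
  have hSd : S * ((1 + 2 * a) * g) ≤ S * ((1 + 2 * a) * d) := mul_le_mul_of_nonneg_left hg' hS.le
  have hlower : (1 + 3 * a) * (S * g) < a * (C * g) + S * ((1 + 2 * a) * d) := by nlinarith
  have hcoef : (1 - a) * ((1 + 3 * a) * (S * g)) < (a + 2) * ((1 + 3 * a) * (S * g)) :=
    mul_lt_mul_of_pos_right (by linarith) (by positivity)
  have hmain := hcoef.trans (mul_lt_mul_of_pos_left hlower (by linarith : 0 < a + 2))
  rw [← sub_neg] at hmain
  refine lt_of_eq_of_lt ?_ hmain
  rw [hgdef]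
  linear_combination 2 * a * (1 + 2 * a) * hid

/-- For `1 < p < 3`, the function
`J(t) = sinh⁴(((p-1)/2)t) · (f_p'(t) - ((p+3)/2) f_p(t))`, where
`f_p(t) = (sinh(pt) - p sinh t)/(4 sinh³((p-1)t/2))`, is strictly negative and
strictly decreasing on `(0, ∞)`. -/
theorem J_neg_and_strictAnti
    (p : ℝ) (hp₁ : 1 < p) (hp₃ : p < 3)
    (f : ℝ → ℝ)
    (hf : ∀ t : ℝ, f t = (Real.sinh (p * t) - p * Real.sinh t)
      / (4 * (Real.sinh ((p - 1) / 2 * t)) ^ 3))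
    (J : ℝ → ℝ)
    (hJ : ∀ t : ℝ, J t = (Real.sinh ((p - 1) / 2 * t)) ^ 4
      * (deriv f t - (p + 3) / 2 * f t)) :
    (∀ t : ℝ, 0 < t → J t < 0) ∧ StrictAntiOn J (Set.Ioi 0) := by
  have hanti := strictAntiOn_numerator hp₁ hp₃
  set K : ℝ → ℝ := fun t => Real.sinh ((p - 1) / 2 * t) * (p * (Real.cosh (p * t) - Real.cosh t))
      - 3 * ((p - 1) / 2) * Real.cosh ((p - 1) / 2 * t) * (Real.sinh (p * t) - p * Real.sinh t)
      - (p + 3) / 2 * Real.sinh ((p - 1) / 2 * t) * (Real.sinh (p * t) - p * Real.sinh t) with hK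
  have hJK (t : ℝ) (ht : 0 < t) : J t = K t / 4 := by
    have hS : Real.sinh ((p - 1) / 2 * t) ≠ 0 :=
      (Real.sinh_pos_iff.2 (mul_pos (by linarith) ht)).ne'
    have hder := (hasDerivAt_sinh_mul_sub_mul_sinh p t).div
      (((hasDerivAt_sinh_const_mul ((p - 1) / 2) t).pow 3).const_mul 4)
      (mul_ne_zero four_ne_zero (pow_ne_zero 3 hS))
    have hfder := hder.congr_of_eventuallyEq (Filter.Eventually.of_forall hf)
    rw [hJ, hfder.deriv, hf, hK]
    simp only [Pi.pow_apply]
    clear hder hfder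
    generalize Real.sinh ((p - 1) / 2 * t) = S at *
    generalize Real.cosh ((p - 1) / 2 * t) = C
    field_simp
    ring
  have hK0 : K 0 = 0 := by simp [hK]
  refine ⟨fun t ht => ?_, fun s hs t ht hst => ?_⟩
  · have := hanti Set.self_mem_Ici ht.le ht
    rw [hJK t ht]
    linarith
  · have := hanti (Set.Ioi_subset_Ici_self hs) (Set.Ioi_subset_Ici_self ht) hst
    rw [hJK s hs, hJK t ht]
    linarith
end
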